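/- Let $b > 0$, $\mu > 0$, and $a \le t$ be real numbers. Let $g, \bar{\rho} : \mathbb{R} \to \mathbb{R}$ be continuous on $[a, t]$ with $\bar{\rho}(\tau) \ge 0$ and $|g(\tau)| - \bar{\rho}(\tau) \ge \mu$ for all $\tau \in [a, t]$. Then $\left| \int_{a}^{t} e^{-b(t-\tau)}\, g(\tau)\, d\tau \right| - \int_{a}^{t} e^{-b(t-\tau)}\, \bar{\rho}(\tau)\, d\tau \ge \frac{\mu}{b}\left(1 - e^{-b(t-a)}\right)$. -/

import Mathlib

theorem exp_weighted_aux
    (b μ a t : ℝ) (hb : 0 < b) (hat : a ≤ t)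
    (g ρbar : ℝ → ℝ)
    (hg : ContinuousOn g (Set.Icc a t))
    (hρ : ContinuousOn ρbar (Set.Icc a t))
    (hgap : ∀ τ ∈ Set.Icc a t, μ ≤ g τ - ρbar τ) :
    μ / b * (1 - Real.exp (-b * (t - a))) ≤
      (∫ τ in a..t, Real.exp (-b * (t - τ)) * g τ) -
        ∫ τ in a..t, Real.exp (-b * (t - τ)) * ρbar τ := by
  have he : Continuous (fun τ : ℝ => Real.exp (-b * (t - τ))) := by fun_prop
  have h1 : IntervalIntegrable (fun τ => Real.exp (-b * (t - τ)) * g τ) MeasureTheory.volume a t :=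
    (he.continuousOn.mul hg).intervalIntegrable_of_Icc hat
  have h2 : IntervalIntegrable (fun τ => Real.exp (-b * (t - τ)) * ρbar τ)
      MeasureTheory.volume a t :=
    (he.continuousOn.mul hρ).intervalIntegrable_of_Icc hat
  have h3 : IntervalIntegrable (fun τ => Real.exp (-b * (t - τ)) * μ) MeasureTheory.volume a t :=
    (he.mul continuous_const).intervalIntegrable a t
  have h4 : ∫ τ in a..t, Real.exp (-b * (t - τ)) * μ = μ / b * (1 - Real.exp (-b * (t - a))) := by
    have hd : ∀ x ∈ Set.uIcc a t, HasDerivAt (fun τ => μ / b * Real.exp (-b * (t - τ)))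
        (Real.exp (-b * (t - x)) * μ) x := by
      intro x _
      have := ((((hasDerivAt_id x).const_sub t).const_mul (-b)).exp).const_mul (μ / b)
      refine HasDerivAt.congr_deriv this ?_
      simp only [id]
      field_simp
    rw [intervalIntegral.integral_eq_sub_of_hasDerivAt hd h3]
    simp
    ring
  rw [← h4, ← intervalIntegral.integral_sub h1 h2]
  apply intervalIntegral.integral_mono_on hat h3 (h1.sub h2)
  intro x hx
  rw [← mul_sub]
  exact mul_le_mul_of_nonneg_left (hgap x hx) (Real.exp_pos _).le

/-- Core exponentially weighted integral estimate in the fault-isolatability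
analysis (Eqs. (30)-(31) of the paper): if `|g| - ρ̄ ≥ μ` pointwise with
`ρ̄ ≥ 0`, then the weighted mismatch integral dominates the weighted envelope
integral by at least `(μ/b)(1 - e^{-b(t-a)})`. -/
theorem exp_weighted_mismatch_integral_lower_bound
    (b μ a t : ℝ) (hb : 0 < b) (hμ : 0 < μ) (hat : a ≤ t)
    (g ρbar : ℝ → ℝ)
    (hg : ContinuousOn g (Set.Icc a t))
    (hρ : ContinuousOn ρbar (Set.Icc a t))
    (hρ0 : ∀ τ ∈ Set.Icc a t, 0 ≤ ρbar τ)
    (hgap : ∀ τ ∈ Set.Icc a t, μ ≤ |g τ| - ρbar τ) :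
    μ / b * (1 - Real.exp (-b * (t - a))) ≤
      |∫ τ in a..t, Real.exp (-b * (t - τ)) * g τ| -
        ∫ τ in a..t, Real.exp (-b * (t - τ)) * ρbar τ := by
  have hne : ∀ τ ∈ Set.Icc a t, g τ ≠ 0 := by
    intro τ hτ h0
    have h1 := hgap τ hτ
    have h2 := hρ0 τ hτ
    rw [h0, abs_zero] at h1
    linarith
  by_cases hs : ∀ τ ∈ Set.Icc a t, 0 ≤ g τ
  · have := exp_weighted_aux b μ a t hb hat g ρbar hg hρ (fun τ hτ => by
      have := hgap τ hτ
      rwa [abs_of_nonneg (hs τ hτ)] at this)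
    exact this.trans (sub_le_sub_right (le_abs_self _) _)
  · push Not at hs
    obtain ⟨x, hx, hgx⟩ := hs
    have hs' : ∀ τ ∈ Set.Icc a t, g τ ≤ 0 := by
      intro y hy
      by_contra! hgy
      obtain ⟨z, hz, hz0⟩ := isPreconnected_Icc.intermediate_value hx hy hg ⟨hgx.le, hgy.le⟩
      exact hne z hz hz0
    have := exp_weighted_aux b μ a t hb hat (fun τ => - g τ) ρbar hg.neg hρ (fun τ hτ => by
      have := hgap τ hτ
      rwa [abs_of_nonpos (hs' τ hτ)] at this)
    simp only [mul_neg, intervalIntegral.integral_neg] at this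
    exact this.trans (sub_le_sub_right (neg_le_abs _) _)
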